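/- arXiv:1004.3525 — 7 statements merged into one kernel-verified Lean document; each statement's English description precedes it below -/
import Mathlib

section
/- Let f : (0,∞) → ℝ be a convex function of class C³. Then there exist a constant α ≥ 0, an integer N ≥ 1, and a sequence (φ_n)_{n≥1} of functions on (0,∞) such that: each φ_n is bounded, nondecreasing and of class C²; for every n ≥ 1, φ_n coincides with f' on the interval [1/n, n]; and for every n ≥ N and all x, y > 0 one has |φ_n(x)| ≤ 4|f'(x)| + α, |φ_n'(x)| ≤ 3 f''(x), and |φ_n(x) − φ_n(y)| ≤ 5|f'(x) − f'(y)|. -/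
open Set

/-- A nondecreasing `C²` function on `(0, ∞)` agrees on `[a, b] ⊆ (0, ∞)`, for `a ≤ 1 ≤ b`, with a
bounded `C²` function whose derivative lies between `0` and that of the original function. -/
theorem exists_bounded_contDiff_two_eqOn_Icc {g : ℝ → ℝ}
    (hg : ContDiffOn ℝ 2 g (Ioi 0)) (hmono : MonotoneOn g (Ioi 0))
    {a b : ℝ} (ha : 0 < a) (ha1 : a ≤ 1) (hb1 : 1 ≤ b) :
    ∃ φ : ℝ → ℝ, ContDiff ℝ 2 φ ∧ (∃ M, ∀ x, |φ x| ≤ M) ∧ EqOn φ g (Icc a b) ∧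
      ∀ x ∈ Ioi (0 : ℝ), 0 ≤ deriv φ x ∧ deriv φ x ≤ derivWithin g (Ioi 0) x := by
  let χ : ContDiffBump ((a + b) / 2) :=
    ⟨(b - a) / 2 + a / 4, (b - a) / 2 + a / 2, by linarith, by linarith⟩
  have hrIn : χ.rIn = (b - a) / 2 + a / 4 := rfl
  have hrOut : χ.rOut = (b - a) / 2 + a / 2 := rfl
  have hg' : ContDiffOn ℝ 1 (derivWithin g (Ioi 0)) (Ioi 0) :=
    hg.derivWithin (uniqueDiffOn_Ioi 0) (by norm_num)
  have hderiv : ∀ x ∈ Ioi (0 : ℝ), HasDerivAt g (derivWithin g (Ioi 0) x) x := fun x hx =>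
    ((hg.differentiableOn (by norm_num)) x hx).hasDerivWithinAt.hasDerivAt (Ioi_mem_nhds hx)
  have hnonneg : ∀ x, 0 ≤ derivWithin g (Ioi 0) x := fun x => hmono.derivWithin_nonneg
  set h : ℝ → ℝ := fun x => χ x * derivWithin g (Ioi 0) x with hh
  have hsupp : HasCompactSupport h := χ.hasCompactSupport.mul_right
  have hC1 : ContDiff ℝ 1 h := by
    rw [contDiff_iff_contDiffAt]
    intro x
    rcases lt_or_ge 0 x with hx | hx
    · exact χ.contDiffAt.mul (hg'.contDiffAt (Ioi_mem_nhds hx))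
    · have hx' : x ∉ tsupport χ := by
        rw [χ.tsupport_eq, Metric.mem_closedBall, Real.dist_eq, hrOut, abs_le]
        intro hmem
        linarith [hmem.1]
      refine (contDiffAt_const (c := (0 : ℝ))).congr_of_eventuallyEq ?_
      filter_upwards [notMem_tsupport_iff_eventuallyEq.mp hx'] with y hy
      simp [hh, hy]
  have hcont : Continuous h := hC1.continuous
  have hint : MeasureTheory.Integrable h := hcont.integrable_of_hasCompactSupport hsupp
  have hφ : ∀ x, HasDerivAt (fun x => g 1 + ∫ t in (1 : ℝ)..x, h t) (h x) x := fun x =>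
    (hcont.integral_hasStrictDerivAt 1 x).hasDerivAt.const_add (g 1)
  refine ⟨fun x => g 1 + ∫ t in (1 : ℝ)..x, h t, ?_, ⟨|g 1| + ∫ t, ‖h t‖, fun x => ?_⟩, ?_, ?_⟩
  · rw [show (2 : WithTop ℕ∞) = 1 + 1 by norm_num, contDiff_succ_iff_deriv]
    refine ⟨fun x => (hφ x).differentiableAt, by simp, ?_⟩
    rwa [show deriv _ = h from funext fun x => (hφ x).deriv]
  · refine (abs_add_le _ _).trans (add_le_add le_rfl ?_)
    refine (intervalIntegral.norm_integral_le_integral_norm_uIoc (f := h)).trans ?_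
    exact MeasureTheory.setIntegral_le_integral hint.norm (.of_forall fun t => norm_nonneg _)
  · intro x hx
    have hsub : uIcc 1 x ⊆ Icc a b := uIcc_subset_Icc ⟨ha1, hb1⟩ hx
    have key : ∫ t in (1 : ℝ)..x, h t = g x - g 1 := by
      refine intervalIntegral.integral_eq_sub_of_hasDerivAt (fun t ht => ?_)
        (hcont.intervalIntegrable _ _)
      obtain ⟨h1, h2⟩ := hsub ht
      have hone : χ t = 1 := by
        refine χ.one_of_mem_closedBall ?_
        rw [Metric.mem_closedBall, Real.dist_eq, hrIn, abs_le]
        constructor <;> linarith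
      simpa [hh, hone] using hderiv t (ha.trans_le h1)
    simp [key]
  · intro x _
    rw [(hφ x).deriv]
    exact ⟨mul_nonneg χ.nonneg (hnonneg x), mul_le_of_le_one_left (hnonneg x) χ.le_one⟩

/-- If `0 ≤ φ' ≤ g'` on `(0, ∞)`, then increments of `φ` are dominated by those of `g`. -/
theorem abs_sub_le_abs_sub_of_deriv_le {φ g : ℝ → ℝ} (hφ : Differentiable ℝ φ)
    (hg : DifferentiableOn ℝ g (Ioi 0))
    (hd : ∀ x ∈ Ioi (0 : ℝ), 0 ≤ deriv φ x ∧ deriv φ x ≤ derivWithin g (Ioi 0) x)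
    {x y : ℝ} (hx : 0 < x) (hy : 0 < y) : |φ x - φ y| ≤ |g x - g y| := by
  have hmφ : MonotoneOn φ (Ioi 0) :=
    monotoneOn_of_deriv_nonneg (convex_Ioi 0) hφ.continuous.continuousOn
      hφ.differentiableOn (by simpa using fun x hx => (hd x hx).1)
  have hmg : MonotoneOn (g - φ) (Ioi 0) := by
    have hdiff := hg.sub hφ.differentiableOn
    refine monotoneOn_of_deriv_nonneg (convex_Ioi 0) hdiff.continuousOn
      (hdiff.mono interior_subset) fun x hx => ?_
    rw [interior_Ioi] at hx
    rw [deriv_sub (hg.differentiableAt (Ioi_mem_nhds hx)) (hφ x),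
      ← derivWithin_of_isOpen isOpen_Ioi hx]
    exact sub_nonneg.2 (hd x hx).2
  wlog hxy : y ≤ x generalizing x y
  · rw [abs_sub_comm, abs_sub_comm (g x)]
    exact this hy hx (le_of_not_ge hxy)
  have h1 := hmφ hy hx hxy
  have h2 := hmg hy hx hxy
  simp only [Pi.sub_apply] at h2
  rw [abs_of_nonneg (by linarith), abs_of_nonneg (by linarith)]
  linarith

/-- Approximation of the derivative of a convex C³ function by bounded
nondecreasing C² functions coinciding with `f'` on `[1/n, n]`, with the
stated domination inequalities for large `n`. -/
theorem approx_of_deriv_convex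
    (f : ℝ → ℝ)
    (hconv : ConvexOn ℝ (Set.Ioi (0:ℝ)) f)
    (hsmooth : ContDiffOn ℝ 3 f (Set.Ioi (0:ℝ))) :
    ∃ α : ℝ, 0 ≤ α ∧ ∃ N : ℕ, 1 ≤ N ∧ ∃ φ : ℕ → ℝ → ℝ,
      (∀ n : ℕ, 1 ≤ n →
        (∃ M : ℝ, ∀ x ∈ Set.Ioi (0:ℝ), |φ n x| ≤ M) ∧
        MonotoneOn (φ n) (Set.Ioi (0:ℝ)) ∧
        ContDiffOn ℝ 2 (φ n) (Set.Ioi (0:ℝ)) ∧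
        (∀ x ∈ Set.Icc ((n:ℝ)⁻¹) (n:ℝ), φ n x = derivWithin f (Set.Ioi 0) x)) ∧
      (∀ n : ℕ, N ≤ n → ∀ x ∈ Set.Ioi (0:ℝ), ∀ y ∈ Set.Ioi (0:ℝ),
        |φ n x| ≤ 4 * |derivWithin f (Set.Ioi 0) x| + α ∧
        |derivWithin (φ n) (Set.Ioi 0) x| ≤
          3 * derivWithin (derivWithin f (Set.Ioi 0)) (Set.Ioi 0) x ∧
        |φ n x - φ n y| ≤
          5 * |derivWithin f (Set.Ioi 0) x - derivWithin f (Set.Ioi 0) y|) := by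
  set g := derivWithin f (Ioi 0) with hgdef
  have hg : ContDiffOn ℝ 2 g (Ioi 0) :=
    hsmooth.derivWithin (uniqueDiffOn_Ioi 0) (by norm_num)
  have hgd : DifferentiableOn ℝ g (Ioi 0) := hg.differentiableOn (by norm_num)
  have hmono : MonotoneOn g (Ioi 0) :=
    hconv.monotoneOn_derivWithin (hsmooth.differentiableOn (by norm_num))
  have hex : ∀ n : ℕ, ∃ φ : ℝ → ℝ, 1 ≤ n → ContDiff ℝ 2 φ ∧ (∃ M, ∀ x, |φ x| ≤ M) ∧
      EqOn φ g (Icc (n : ℝ)⁻¹ n) ∧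
      ∀ x ∈ Ioi (0 : ℝ), 0 ≤ deriv φ x ∧ deriv φ x ≤ derivWithin g (Ioi 0) x := by
    intro n
    by_cases hn : 1 ≤ n
    · have hn' : (1 : ℝ) ≤ n := by exact_mod_cast hn
      obtain ⟨φ, hφ⟩ := exists_bounded_contDiff_two_eqOn_Icc hg hmono
        (inv_pos.2 (by linarith)) (inv_le_one_of_one_le₀ hn') hn'
      exact ⟨φ, fun _ => hφ⟩
    · exact ⟨0, fun h => absurd h hn⟩
  choose φ hφ using hex
  refine ⟨2 * |g 1|, by positivity, 1, le_rfl, φ, fun n hn => ?_, fun n hn x hx y hy => ?_⟩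
  · obtain ⟨hC, ⟨M, hM⟩, heq, hd⟩ := hφ n hn
    refine ⟨⟨M, fun x _ => hM x⟩, ?_, hC.contDiffOn, heq⟩
    exact monotoneOn_of_deriv_nonneg (convex_Ioi 0) hC.continuous.continuousOn
      (hC.differentiable (by norm_num)).differentiableOn
      (by simpa using fun x hx => (hd x hx).1)
  · obtain ⟨hC, -, heq, hd⟩ := hφ n hn
    have hn' : (1 : ℝ) ≤ n := by exact_mod_cast hn
    have hinc := fun {u v : ℝ} (hu : 0 < u) (hv : 0 < v) =>
      abs_sub_le_abs_sub_of_deriv_le (hC.differentiable (by norm_num)) hgd hd hu hv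
    obtain ⟨h0, h1⟩ := hd x hx
    refine ⟨?_, ?_, ?_⟩
    · have h := hinc hx one_pos
      rw [heq ⟨inv_le_one_of_one_le₀ hn', hn'⟩] at h
      have h2 := abs_sub_abs_le_abs_sub (φ n x) (g 1)
      have h3 := abs_sub (g x) (g 1)
      linarith [abs_nonneg (g x)]
    · rw [derivWithin_of_isOpen isOpen_Ioi hx, abs_of_nonneg h0]
      linarith
    · linarith [hinc hx hy, abs_nonneg (g x - g y)]
end

section
/- Let a > 0 and γ ∈ ℝ, and let f : (0,∞) → ℝ be twice differentiable with f''(x) = a·x^γ for all x > 0. Then for every c > 0 there exist constants A > 0 and B, C ∈ ℝ such that f(c·x) = A·f(x) + B·x + C for all x > 0; one may take A = c^{γ+2} when γ ∉ {−1, −2}, A = c when γ = −1, and A = 1 when γ = −2. -/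
open Set

theorem eq_of_hasDerivAt_zero_on_Ioi {g : ℝ → ℝ}
    (hg : ∀ x ∈ Ioi (0 : ℝ), HasDerivAt g 0 x) {x y : ℝ}
    (hx : x ∈ Ioi (0 : ℝ)) (hy : y ∈ Ioi (0 : ℝ)) : g x = g y :=
  isOpen_Ioi.is_const_of_deriv_eq_zero isPreconnected_Ioi
    (fun z hz => (hg z hz).differentiableAt.differentiableWithinAt)
    (fun z hz => (hg z hz).deriv) hx hy

theorem exists_affine_of_second_deriv_zero_on_Ioi {g g' : ℝ → ℝ}
    (hg : ∀ x ∈ Ioi (0 : ℝ), HasDerivAt g (g' x) x)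
    (hg' : ∀ x ∈ Ioi (0 : ℝ), HasDerivAt g' 0 x) :
    ∃ B C : ℝ, ∀ x ∈ Ioi (0 : ℝ), g x = B * x + C := by
  have h1 : (1 : ℝ) ∈ Ioi (0 : ℝ) := mem_Ioi.mpr one_pos
  refine ⟨g' 1, g 1 - g' 1, fun x hx => ?_⟩
  have hzero : ∀ y ∈ Ioi (0 : ℝ), HasDerivAt (fun z => g z - g' 1 * z) 0 y := by
    intro y hy
    refine ((hg y hy).sub ((hasDerivAt_id y).const_mul (g' 1))).congr_deriv ?_
    rw [eq_of_hasDerivAt_zero_on_Ioi hg' hy h1]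
    ring
  have hconst := eq_of_hasDerivAt_zero_on_Ioi hzero hx h1
  linarith

/-- Scaling property of functions with `f''(x) = a x^γ`: for every `c > 0` there are
constants `A > 0`, `B`, `C` with `f(cx) = A f(x) + Bx + C`, where one may take
`A = c^(γ+2)` if `γ ∉ {-1,-2}`, `A = c` if `γ = -1` and `A = 1` if `γ = -2`. -/
theorem scaling_of_f_of_second_deriv_power
    (a γ : ℝ) (ha : 0 < a) (f f' : ℝ → ℝ)
    (hf' : ∀ x ∈ Set.Ioi (0:ℝ), HasDerivAt f (f' x) x)
    (hf'' : ∀ x ∈ Set.Ioi (0:ℝ), HasDerivAt f' (a * x ^ γ) x) :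
    ∀ c : ℝ, 0 < c → ∃ B C : ℝ,
      0 < (if γ = -1 then c else if γ = -2 then 1 else c ^ (γ + 2)) ∧
      ∀ x ∈ Set.Ioi (0:ℝ),
        f (c * x) = (if γ = -1 then c else if γ = -2 then 1 else c ^ (γ + 2)) * f x
          + B * x + C := by
  intro c hc
  have hA : (if γ = -1 then c else if γ = -2 then 1 else c ^ (γ + 2)) = c ^ (γ + 2) := by
    split_ifs with h1 h2
    · norm_num [h1]
    · simp [h2]
    · rfl
  rw [hA]
  have hpos : ∀ x ∈ Ioi (0 : ℝ), c * x ∈ Ioi (0 : ℝ) := fun x hx => mul_pos hc hx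
  have hlin (x : ℝ) : HasDerivAt (fun y => c * y) c x := by
    simpa using (hasDerivAt_id x).const_mul c
  obtain ⟨B, C, h⟩ := exists_affine_of_second_deriv_zero_on_Ioi
    (g := fun x => f (c * x) - c ^ (γ + 2) * f x)
    (g' := fun x => f' (c * x) * c - c ^ (γ + 2) * f' x)
    (fun x hx => ((hf' _ (hpos x hx)).comp x (hlin x)).sub ((hf' x hx).const_mul _))
    (fun x hx => by
      refine ((((hf'' _ (hpos x hx)).comp x (hlin x)).mul_const c).sub
        ((hf'' x hx).const_mul _)).congr_deriv ?_
      rw [Real.mul_rpow hc.le (le_of_lt hx), Real.rpow_add hc, Real.rpow_two]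
      ring)
  refine ⟨B, C, Real.rpow_pos_of_pos hc _, fun x hx => ?_⟩
  linarith [h x hx]
end

section
/- Let (Ω, 𝒜, P) be a probability space and Z : Ω → (0,∞) a measurable function with E_P[Z] = 1. Let x̲ ∈ [−∞, ∞), let u : (x̲, ∞) → ℝ be concave, and let f(y) = sup_{x > x̲}(u(x) − x·y) for y > 0; assume f is finite and differentiable on (0,∞) and that for every y > 0 the supremum is attained at the point −f'(y), i.e. −f'(y) > x̲ and u(−f'(y)) = f(y) − y·f'(y). Fix λ > 0 such that f(λZ) and Z·f'(λZ) are P-integrable, and set W* := −f'(λZ) and x := −E_P[Z·f'(λZ)]. Then E_P[u(W*)] = E_P[f(λZ)] + λ·x, and for every measurable W : Ω → (x̲, ∞) such that Z·W is P-integrable with E_P[Z·W] ≤ x and u(W) is P-integrable, one has E_P[u(W)] ≤ E_P[u(W*)]. -/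
open MeasureTheory

/-- Utility maximisation via the convex conjugate: the terminal wealth
`W* = -f'(λZ)` attains `E[u(W*)] = E[f(λZ)] + λx` with `x = -E[Z f'(λZ)]`, and
it maximises expected utility among all claims `W` with `E[ZW] ≤ x`. -/
theorem optimal_wealth_of_conjugate
    {Ω : Type*} [MeasurableSpace Ω] (P : Measure Ω) [IsProbabilityMeasure P]
    (Z : Ω → ℝ) (hZmeas : Measurable Z) (hZpos : ∀ ω, 0 < Z ω)
    (hZint : Integrable Z P) (hZone : ∫ ω, Z ω ∂P = 1)
    (xlb : EReal) (hxlb : xlb < ⊤)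
    (u : ℝ → ℝ) (hu : ConcaveOn ℝ {x : ℝ | xlb < (x : EReal)} u)
    (f : ℝ → ℝ) (hfdiff : ∀ y : ℝ, 0 < y → DifferentiableAt ℝ f y)
    (hfub : ∀ y : ℝ, 0 < y → ∀ x : ℝ, xlb < (x : EReal) → u x - x * y ≤ f y)
    (hfattain : ∀ y : ℝ, 0 < y →
      xlb < ((-deriv f y : ℝ) : EReal) ∧ u (-deriv f y) = f y - y * deriv f y)
    (lam : ℝ) (hlam : 0 < lam)
    (hint1 : Integrable (fun ω => f (lam * Z ω)) P)
    (hint2 : Integrable (fun ω => Z ω * deriv f (lam * Z ω)) P) :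
    (∫ ω, u (-(deriv f (lam * Z ω))) ∂P
      = ∫ ω, f (lam * Z ω) ∂P + lam * (-∫ ω, Z ω * deriv f (lam * Z ω) ∂P)) ∧
    ∀ W : Ω → ℝ, (∀ ω, xlb < ((W ω : ℝ) : EReal)) →
      Integrable (fun ω => Z ω * W ω) P →
      (∫ ω, Z ω * W ω ∂P ≤ -∫ ω, Z ω * deriv f (lam * Z ω) ∂P) →
      Integrable (fun ω => u (W ω)) P →
      ∫ ω, u (W ω) ∂P ≤ ∫ ω, u (-(deriv f (lam * Z ω))) ∂P := by
  have hscaled := hint2.const_mul lam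
  have hopt : ∫ ω, u (-(deriv f (lam * Z ω))) ∂P
      = ∫ ω, f (lam * Z ω) ∂P + lam * (-∫ ω, Z ω * deriv f (lam * Z ω) ∂P) := by
    have hpt : ∀ ω, u (-(deriv f (lam * Z ω)))
        = f (lam * Z ω) - lam * (Z ω * deriv f (lam * Z ω)) := fun ω => by
      rw [(hfattain _ (mul_pos hlam (hZpos ω))).2, mul_assoc]
    simp_rw [hpt]
    rw [integral_sub hint1 hscaled, integral_const_mul]
    ring
  refine ⟨hopt, fun W hW hZW hbudget huW => ?_⟩
  calc ∫ ω, u (W ω) ∂P ≤ ∫ ω, (f (lam * Z ω) + lam * (Z ω * W ω)) ∂P := by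
        refine integral_mono huW (hint1.add (hZW.const_mul lam)) fun ω => ?_
        have := hfub _ (mul_pos hlam (hZpos ω)) _ (hW ω)
        dsimp only
        linarith
    _ = ∫ ω, f (lam * Z ω) ∂P + lam * ∫ ω, Z ω * W ω ∂P := by
        rw [integral_add hint1 (hZW.const_mul lam), integral_const_mul]
    _ ≤ ∫ ω, f (lam * Z ω) ∂P + lam * (-∫ ω, Z ω * deriv f (lam * Z ω) ∂P) := by
        gcongr
    _ = ∫ ω, u (-(deriv f (lam * Z ω))) ∂P := hopt.symm
end

section
/- Let (Ω, 𝒜, P) be a probability space and Z : Ω → (0,∞) a measurable function with E_P[Z] = 1. Let g : (0,∞) → ℝ be continuous and strictly increasing with g(y) → −∞ as y → 0⁺, and assume that Z·g(λ·Z) is P-integrable for every λ > 0. Then the function Λ(λ) := E_P[Z·g(λ·Z)] is strictly increasing and continuous on (0,∞), Λ(λ) → −∞ as λ → 0⁺, and consequently for every x ∈ ℝ with x < sup_{λ>0} Λ(λ) there exists a unique λ > 0 such that Λ(λ) = x. -/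
open MeasureTheory Filter Set

/-- The function `Λ(λ) = E[Z g(λZ)]` is strictly increasing and continuous on
`(0,∞)`, tends to `-∞` as `λ → 0⁺`, and hence for every `x` below its supremum
there is a unique `λ > 0` with `Λ(λ) = x`. -/
theorem lagrange_function_properties
    {Ω : Type*} [MeasurableSpace Ω] (P : Measure Ω) [IsProbabilityMeasure P]
    (Z : Ω → ℝ) (hZmeas : Measurable Z) (hZpos : ∀ ω, 0 < Z ω)
    (hZint : Integrable Z P) (hZone : ∫ ω, Z ω ∂P = 1)
    (g : ℝ → ℝ) (hgcont : ContinuousOn g (Set.Ioi (0:ℝ)))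
    (hgmono : StrictMonoOn g (Set.Ioi (0:ℝ)))
    (hgbot : Tendsto g (nhdsWithin 0 (Set.Ioi (0:ℝ))) atBot)
    (hint : ∀ l : ℝ, 0 < l → Integrable (fun ω => Z ω * g (l * Z ω)) P) :
    StrictMonoOn (fun l : ℝ => ∫ ω, Z ω * g (l * Z ω) ∂P) (Set.Ioi (0:ℝ)) ∧
    ContinuousOn (fun l : ℝ => ∫ ω, Z ω * g (l * Z ω) ∂P) (Set.Ioi (0:ℝ)) ∧
    Tendsto (fun l : ℝ => ∫ ω, Z ω * g (l * Z ω) ∂P)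
      (nhdsWithin 0 (Set.Ioi (0:ℝ))) atBot ∧
    ∀ x : ℝ, (∃ l : ℝ, 0 < l ∧ x < ∫ ω, Z ω * g (l * Z ω) ∂P) →
      ∃! l : ℝ, 0 < l ∧ ∫ ω, Z ω * g (l * Z ω) ∂P = x := by
  have hlt : ∀ a b : ℝ, 0 < a → a < b → ∀ ω, Z ω * g (a * Z ω) < Z ω * g (b * Z ω) :=
    fun a b ha hab ω => mul_lt_mul_of_pos_left
      (hgmono (mul_pos ha (hZpos ω)) (mul_pos (ha.trans hab) (hZpos ω))
        (mul_lt_mul_of_pos_right hab (hZpos ω))) (hZpos ω)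
  have hle : ∀ a b : ℝ, 0 < a → a ≤ b → ∀ ω, Z ω * g (a * Z ω) ≤ Z ω * g (b * Z ω) := by
    intro a b ha hab ω
    rcases hab.eq_or_lt with rfl | h
    · exact le_rfl
    · exact (hlt a b ha h ω).le
  have hmono : StrictMonoOn (fun l : ℝ => ∫ ω, Z ω * g (l * Z ω) ∂P) (Set.Ioi (0:ℝ)) := by
    intro a ha b hb hab
    have hpos : 0 < ∫ ω, (Z ω * g (b * Z ω) - Z ω * g (a * Z ω)) ∂P := by
      rw [integral_pos_iff_support_of_nonneg
        (fun ω => sub_nonneg.2 (hlt a b ha hab ω).le) ((hint b hb).sub (hint a ha))]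
      have : Function.support (fun ω => Z ω * g (b * Z ω) - Z ω * g (a * Z ω)) = univ :=
        eq_univ_of_forall fun ω => (sub_pos.2 (hlt a b ha hab ω)).ne'
      rw [this]
      simp
    rw [integral_sub (hint b hb) (hint a ha)] at hpos
    exact sub_pos.1 hpos
  have hcont : ContinuousOn (fun l : ℝ => ∫ ω, Z ω * g (l * Z ω) ∂P) (Set.Ioi (0:ℝ)) := by
    intro l hl
    have hl : 0 < l := hl
    refine ContinuousAt.continuousWithinAt ?_
    have hmem : Ioo (l / 2) (2 * l) ∈ nhds l := Ioo_mem_nhds (by linarith) (by linarith)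
    refine continuousAt_of_dominated
      (bound := fun ω => |Z ω * g (l / 2 * Z ω)| + |Z ω * g (2 * l * Z ω)|) ?_ ?_ ?_ ?_
    · filter_upwards [Ioi_mem_nhds hl] with t ht using (hint t ht).aestronglyMeasurable
    · filter_upwards [hmem] with t ht
      refine ae_of_all _ fun ω => ?_
      have h1 := hle (l / 2) t (by linarith) ht.1.le ω
      have h2 := hle t (2 * l) (by linarith [ht.1]) ht.2.le ω
      rw [Real.norm_eq_abs, abs_le]
      constructor
      · linarith [neg_abs_le (Z ω * g (l / 2 * Z ω)), abs_nonneg (Z ω * g (2 * l * Z ω))]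
      · linarith [le_abs_self (Z ω * g (2 * l * Z ω)), abs_nonneg (Z ω * g (l / 2 * Z ω))]
    · exact (hint _ (by linarith)).abs.add (hint _ (by linarith)).abs
    · refine ae_of_all _ fun ω => continuousAt_const.mul ?_
      have hg : ContinuousAt g (l * Z ω) :=
        hgcont.continuousAt (Ioi_mem_nhds (mul_pos hl (hZpos ω)))
      exact ContinuousAt.comp (f := fun t : ℝ => t * Z ω) hg (by fun_prop)
  have hbot : Tendsto (fun l : ℝ => ∫ ω, Z ω * g (l * Z ω) ∂P)
      (nhdsWithin 0 (Set.Ioi (0:ℝ))) atBot := by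
    obtain ⟨n, hn⟩ : ∃ n : ℕ, 0 < P {ω | Z ω ≤ n} := by
      refine exists_measure_pos_of_not_measure_iUnion_null ?_
      have : (⋃ n : ℕ, {ω | Z ω ≤ n}) = univ :=
        eq_univ_of_forall fun ω => mem_iUnion.2 (exists_nat_ge (Z ω))
      rw [this]
      simp
    obtain ⟨M, hMpos, hM⟩ : ∃ M : ℝ, 0 < M ∧ 0 < P {ω | Z ω ≤ M} :=
      ⟨n + 1, by positivity, hn.trans_le (measure_mono fun ω (h : Z ω ≤ n) =>
        h.trans (by linarith))⟩
    set S : Set Ω := {ω | Z ω ≤ M} with hS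
    have hSm : MeasurableSet S := measurableSet_le hZmeas measurable_const
    have hc : 0 < ∫ ω in S, Z ω ∂P := by
      rw [setIntegral_pos_iff_support_of_nonneg_ae (ae_of_all _ fun ω => (hZpos ω).le)
        hZint.integrableOn]
      have : Function.support Z = univ := eq_univ_of_forall fun ω => (hZpos ω).ne'
      rwa [this, univ_inter]
    have hscale : Tendsto (fun l : ℝ => l * M) (nhdsWithin 0 (Ioi 0)) (nhdsWithin 0 (Ioi 0)) := by
      refine tendsto_nhdsWithin_iff.2 ⟨?_, ?_⟩
      · have : Tendsto (fun l : ℝ => l * M) (nhds 0) (nhds (0 * M)) :=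
          tendsto_id.mul_const M
        rw [zero_mul] at this
        exact this.mono_left nhdsWithin_le_nhds
      · filter_upwards [self_mem_nhdsWithin] with l hl using mul_pos hl hMpos
    have hlim := tendsto_atBot_add_const_right _ (∫ ω in Sᶜ, Z ω * g (1 * Z ω) ∂P)
      ((hgbot.comp hscale).const_mul_atBot hc)
    refine tendsto_atBot_mono' _ ?_ hlim
    filter_upwards [Ioo_mem_nhdsGT (zero_lt_one (α := ℝ))] with l hl
    rw [← integral_add_compl hSm (hint l hl.1)]
    refine add_le_add ?_ ?_
    · rw [← integral_mul_const]
      refine setIntegral_mono_on (hint l hl.1).integrableOn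
        (hZint.mul_const _).integrableOn hSm fun ω hω => ?_
      exact mul_le_mul_of_nonneg_left (hgmono.monotoneOn (mul_pos hl.1 (hZpos ω))
        (mul_pos hl.1 hMpos) (mul_le_mul_of_nonneg_left hω hl.1.le)) (hZpos ω).le
    · exact setIntegral_mono (hint l hl.1).integrableOn (hint 1 one_pos).integrableOn
        (hle l 1 hl.1 hl.2.le)
  refine ⟨hmono, hcont, hbot, ?_⟩
  rintro x ⟨b, hb, hxb⟩
  obtain ⟨a, hax, ha⟩ :=
    ((hbot.eventually_le_atBot x).and self_mem_nhdsWithin).exists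
  obtain ⟨l, hl, hlx⟩ := isPreconnected_Ioi.intermediate_value ha hb hcont ⟨hax, hxb.le⟩
  exact ⟨l, ⟨hl, hlx⟩, fun m hm => hmono.injOn hm.1 hl (hm.2.trans hlx.symm)⟩
end

section
/- Let (Ω, 𝒜, P) be a probability space and let M = (M_t)_{t≥0} and M̃ = (M̃_t)_{t≥0} be real-valued stochastic processes such that the σ-algebras σ(M_s : s ≥ 0) and σ(M̃_s : s ≥ 0) are independent under P. Let 𝒢_t := σ(M_s, M̃_s : s ≤ t). Assume that M is a (P, 𝒢)-martingale and that M̃ is a strictly positive (P, 𝒢)-martingale. Then for every fixed u ≥ 0, the process N = (N_t)_{t≥0} defined by N_t := M_{t∧u} · M̃_t / M̃_{t∧u} is a (P, 𝒢)-martingale; in particular N_t is P-integrable for every t ≥ 0. -/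
open MeasureTheory ProbabilityTheory
open scoped NNReal

/-- A ratio `Y / X` of strictly positive random variables such that `X` is the conditional
expectation of `Y` given `m` is integrable, even when `1 / X` is unbounded. -/
theorem integrable_div_of_condExp_ae_eq
    {Ω : Type*} {m m₀ : MeasurableSpace Ω} {P : Measure[m₀] Ω} [IsFiniteMeasure P]
    (hm : m ≤ m₀) {X Y : Ω → ℝ} (hX : Measurable[m] X) (hY : Measurable[m₀] Y)
    (hXpos : ∀ ω, 0 < X ω) (hYpos : ∀ ω, 0 < Y ω)
    (hXint : Integrable X P) (hYint : Integrable Y P) (h : P[Y | m] =ᵐ[P] X) :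
    Integrable (fun ω => Y ω / X ω) P := by
  have hX₀ : Measurable[m₀] X := hX.mono hm le_rfl
  have hinv : Measurable[m] fun ω => ENNReal.ofReal (X ω)⁻¹ := hX.inv.ennreal_ofReal
  have htrim : (P.withDensity fun ω => ENNReal.ofReal (Y ω)).trim hm =
      (P.withDensity fun ω => ENNReal.ofReal (X ω)).trim hm := by
    refine @Measure.ext _ m _ _ fun s hs => ?_
    rw [trim_measurableSet_eq hm hs, trim_measurableSet_eq hm hs,
      withDensity_apply _ (hm s hs), withDensity_apply _ (hm s hs),
      ← ofReal_integral_eq_lintegral_ofReal hYint.integrableOn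
        (ae_of_all _ fun ω => (hYpos ω).le),
      ← ofReal_integral_eq_lintegral_ofReal hXint.integrableOn
        (ae_of_all _ fun ω => (hXpos ω).le),
      ← setIntegral_condExp hm hYint hs]
    congr 1
    exact setIntegral_congr_ae (hm s hs) (h.mono fun ω hω _ => hω)
  have hlint : ∫⁻ ω, ENNReal.ofReal (Y ω) * ENNReal.ofReal (X ω)⁻¹ ∂P =
      ∫⁻ ω, ENNReal.ofReal (X ω) * ENNReal.ofReal (X ω)⁻¹ ∂P := by
    have hd : ∀ {Z : Ω → ℝ}, Measurable[m₀] Z →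
        ∫⁻ ω, ENNReal.ofReal (Z ω) * ENNReal.ofReal (X ω)⁻¹ ∂P =
          ∫⁻ ω, ENNReal.ofReal (X ω)⁻¹
            ∂((P.withDensity fun ω => ENNReal.ofReal (Z ω)).trim hm) := fun hZ => by
      rw [lintegral_trim hm hinv,
        lintegral_withDensity_eq_lintegral_mul _ hZ.ennreal_ofReal (hinv.mono hm le_rfl)]
      rfl
    rw [hd hY, hd hX₀, htrim]
  refine ⟨(hY.div hX₀).aestronglyMeasurable, ?_⟩
  rw [hasFiniteIntegral_iff_ofReal (ae_of_all _ fun ω => (div_pos (hYpos ω) (hXpos ω)).le)]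
  simp_rw [div_eq_mul_inv, ENNReal.ofReal_mul (hYpos _).le]
  rw [hlint]
  simp_rw [← ENNReal.ofReal_mul (hXpos _).le, mul_inv_cancel₀ (hXpos _).ne']
  simp

/-- Pasting of two independent positive martingales at a deterministic time `u`:
the process `N_t = M_{t∧u} · M̃_t / M̃_{t∧u}` is again a martingale. -/
theorem pasted_process_is_martingale
    {Ω : Type*} [MeasurableSpace Ω] (P : Measure Ω) [IsProbabilityMeasure P]
    (M Mt : ℝ≥0 → Ω → ℝ)
    (hMmeas : ∀ s, Measurable (M s)) (hMtmeas : ∀ s, Measurable (Mt s))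
    (hindep : ProbabilityTheory.Indep
      (⨆ s : ℝ≥0, MeasurableSpace.comap (M s) inferInstance)
      (⨆ s : ℝ≥0, MeasurableSpace.comap (Mt s) inferInstance) P)
    (G : ℝ≥0 → MeasurableSpace Ω)
    (hG : ∀ t, G t = ⨆ s ∈ Set.Iic t,
      (MeasurableSpace.comap (M s) inferInstance ⊔
       MeasurableSpace.comap (Mt s) inferInstance))
    (hMint : ∀ t, Integrable (M t) P)
    (hMadapted : ∀ t, Measurable[G t] (M t))
    (hMmart : ∀ s t : ℝ≥0, s ≤ t → P[M t | G s] =ᵐ[P] M s)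
    (hMtpos : ∀ t ω, 0 < Mt t ω)
    (hMtint : ∀ t, Integrable (Mt t) P)
    (hMtadapted : ∀ t, Measurable[G t] (Mt t))
    (hMtmart : ∀ s t : ℝ≥0, s ≤ t → P[Mt t | G s] =ᵐ[P] Mt s)
    (u : ℝ≥0) :
    (∀ t, Integrable (fun ω => M (min t u) ω * Mt t ω / Mt (min t u) ω) P) ∧
    (∀ t, Measurable[G t] (fun ω => M (min t u) ω * Mt t ω / Mt (min t u) ω)) ∧
    (∀ s t : ℝ≥0, s ≤ t →
      P[fun ω => M (min t u) ω * Mt t ω / Mt (min t u) ω | G s]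
        =ᵐ[P] fun ω => M (min s u) ω * Mt s ω / Mt (min s u) ω) := by
  have hle : ∀ t, G t ≤ ‹MeasurableSpace Ω› := fun t => by
    rw [hG]
    exact iSup₂_le fun s _ => sup_le (hMmeas s).comap_le (hMtmeas s).comap_le
  have hmono : ∀ s t, s ≤ t → G s ≤ G t := fun s t hst => by
    rw [hG, hG]
    exact biSup_mono fun r hr => le_trans hr hst
  have hbefore : ∀ t ≤ u,
      (fun ω => M (min t u) ω * Mt t ω / Mt (min t u) ω) = M t := fun t htu => by
    funext ω
    rw [min_eq_left htu, mul_div_cancel_right₀ _ (hMtpos t ω).ne']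
  have hafter : ∀ t, u ≤ t → (fun ω => M (min t u) ω * Mt t ω / Mt (min t u) ω) =
      fun ω => M u ω / Mt u ω * Mt t ω := fun t hut => by
    funext ω
    rw [min_eq_right hut]
    ring
  have hint : ∀ t, Integrable (fun ω => M (min t u) ω * Mt t ω / Mt (min t u) ω) P := by
    intro t
    rcases le_total t u with htu | hut
    · rw [hbefore t htu]
      exact hMint t
    · have hratio : Integrable (fun ω => Mt t ω / Mt u ω) P :=
        integrable_div_of_condExp_ae_eq (hle u) (hMtadapted u) (hMtmeas t) (hMtpos u)
          (hMtpos t) (hMtint u) (hMtint t) (hMtmart u t hut)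
      have hMt : ∀ s, Measurable[⨆ s : ℝ≥0, MeasurableSpace.comap (Mt s) inferInstance]
          (Mt s) := fun s =>
        (comap_measurable (Mt s)).mono
          (le_iSup (fun s => MeasurableSpace.comap (Mt s) inferInstance) s) le_rfl
      have hind : IndepFun (M u) (fun ω => Mt t ω / Mt u ω) P :=
        (IndepFun_iff_Indep _ _ _).2 <|
          indep_of_indep_of_le_left
            (indep_of_indep_of_le_right hindep ((hMt t).div (hMt u)).comap_le)
            (le_iSup (fun s => MeasurableSpace.comap (M s) inferInstance) u)
      convert hind.integrable_mul (hMint u) hratio using 1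
      funext ω
      simp only [min_eq_right hut, Pi.mul_apply, mul_div_assoc]
  have hmart_after : ∀ s t, u ≤ s → s ≤ t →
      P[fun ω => M (min t u) ω * Mt t ω / Mt (min t u) ω | G s]
        =ᵐ[P] fun ω => M (min s u) ω * Mt s ω / Mt (min s u) ω := by
    intro s t hus hst
    have hi := hint t
    rw [hafter t (hus.trans hst)] at hi ⊢
    rw [hafter s hus]
    have hf : Measurable[G s] fun ω => M u ω / Mt u ω :=
      ((hMadapted u).div (hMtadapted u)).mono (hmono u s hus) le_rfl
    filter_upwards [condExp_mul_of_stronglyMeasurable_left hf.stronglyMeasurable hi (hMtint t),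
      hMtmart s t hst] with ω h₁ h₂
    exact h₁.trans (by rw [Pi.mul_apply, h₂])
  refine ⟨hint, fun t => ?_, fun s t hst => ?_⟩
  · have hmin := hmono (min t u) t (min_le_left t u)
    exact (((hMadapted _).mono hmin le_rfl).mul (hMtadapted t)).div
      ((hMtadapted _).mono hmin le_rfl)
  · rcases le_total u s with hus | hsu
    · exact hmart_after s t hus hst
    rw [hbefore s hsu]
    rcases le_total t u with htu | hut
    · rw [hbefore t htu]
      exact hMmart s t hst
    · have hu := hmart_after u t le_rfl hut
      rw [hbefore u le_rfl] at hu
      exact (condExp_condExp_of_le (hmono s u hsu) (hle u)).symm.trans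
        ((condExp_congr_ae hu).trans (hMmart s u hsu))
end

section
/- Let (Ω, 𝒜, P) be a probability space, T > 0, 𝒢 = (𝒢_t)_{t ∈ [0,T]} a filtration with 𝒢_T ⊆ 𝒜, and τ : Ω → [0,T] a random variable such that σ(τ) is independent of 𝒢_T under P; let μ_τ denote the law of τ. Let N : [0,T] × [0,T] × Ω → ℝ, written (u, t, ω) ↦ N^u_t(ω), be such that: for each t ∈ [0,T], the map (u, ω) ↦ N^u_t(ω) is measurable with respect to ℬ([0,T]) ⊗ 𝒢_t; for each u ∈ [0,T], the process (N^u_t)_{t ∈ [0,T]} is a (P, 𝒢)-martingale; and ∫_{[0,T]} E_P|N^u_t| μ_τ(du) < ∞ for each t ∈ [0,T]. Define the initially enlarged filtration ℱ_t := 𝒢_t ∨ σ(τ). Then the process (N^τ_t)_{t ∈ [0,T]}, defined by ω ↦ N^{τ(ω)}_t(ω), is a (P, ℱ)-martingale. -/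
open MeasureTheory ProbabilityTheory Set

/-- For independent `X` and `Y`, a jointly measurable function of `(X, Y)` is integrable as soon as
its sections are integrable and the `L¹` norms of the sections are integrable in the law of `X`. -/
theorem integrable_comp_prodMk_of_indepFun {Ω E F : Type*} [MeasurableSpace Ω]
    [MeasurableSpace E] [MeasurableSpace F] {P : Measure Ω} [IsProbabilityMeasure P]
    {X : Ω → E} {Y : Ω → F} (hX : Measurable X) (hY : Measurable Y) (hXY : IndepFun X Y P)
    {f : E × F → ℝ} (hf : Measurable f)
    (hsec : ∀ᵐ u ∂P.map X, Integrable (fun ω => f (u, Y ω)) P)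
    (hnorm : Integrable (fun u => ∫ ω, |f (u, Y ω)| ∂P) (P.map X)) :
    Integrable (fun ω => f (X ω, Y ω)) P := by
  have := Measure.isProbabilityMeasure_map (μ := P) hX.aemeasurable
  have := Measure.isProbabilityMeasure_map (μ := P) hY.aemeasurable
  have hmap := (indepFun_iff_map_prod_eq_prod_map_map hX.aemeasurable hY.aemeasurable).1 hXY
  suffices h : Integrable f (P.map fun ω => (X ω, Y ω)) from
    h.comp_measurable (hX.prodMk hY)
  rw [hmap, integrable_prod_iff hf.aestronglyMeasurable]
  have hfu (u : E) : Measurable fun y => f (u, y) := hf.comp measurable_prodMk_left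
  refine ⟨hsec.mono fun u hu => ?_, hnorm.congr (ae_of_all _ fun u => ?_)⟩
  · exact (integrable_map_measure (hfu u).aestronglyMeasurable hY.aemeasurable).2 hu
  · exact (integral_map hY.aemeasurable (hfu u).norm.aestronglyMeasurable).symm

/-- For independent `X` and `Y`, the integral of `f (X, Y)` over an event `(X, Y) ∈ D` is computed
by freezing `X` and integrating over its law. -/
theorem setIntegral_comp_prodMk_of_indepFun {Ω E F : Type*} [MeasurableSpace Ω]
    [MeasurableSpace E] [MeasurableSpace F] {P : Measure Ω} [IsProbabilityMeasure P]
    {X : Ω → E} {Y : Ω → F} (hX : Measurable X) (hY : Measurable Y) (hXY : IndepFun X Y P)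
    {f : E × F → ℝ} (hf : Measurable f) (hfXY : Integrable (fun ω => f (X ω, Y ω)) P)
    {D : Set (E × F)} (hD : MeasurableSet D) :
    ∫ ω in (fun ω => (X ω, Y ω)) ⁻¹' D, f (X ω, Y ω) ∂P
      = ∫ u, ∫ ω in {ω | (u, Y ω) ∈ D}, f (u, Y ω) ∂P ∂P.map X := by
  have := Measure.isProbabilityMeasure_map (μ := P) hX.aemeasurable
  have := Measure.isProbabilityMeasure_map (μ := P) hY.aemeasurable
  have hmap := (indepFun_iff_map_prod_eq_prod_map_map hX.aemeasurable hY.aemeasurable).1 hXY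
  have hXYm : Measurable fun ω => (X ω, Y ω) := hX.prodMk hY
  have hDf : Measurable (D.indicator f) := hf.indicator hD
  have hfi : Integrable f (P.map fun ω => (X ω, Y ω)) :=
    (integrable_map_measure hf.aestronglyMeasurable hXYm.aemeasurable).2 hfXY
  rw [← setIntegral_map hD hf.aestronglyMeasurable hXYm.aemeasurable, ← integral_indicator hD,
    hmap, integral_prod _ (by rw [← hmap]; exact hfi.indicator hD)]
  refine integral_congr_ae (ae_of_all _ fun u => ?_)
  have hsec : Measurable fun y => D.indicator f (u, y) := hDf.comp measurable_prodMk_left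
  have hDu : MeasurableSet {ω | (u, Y ω) ∈ D} := (measurable_const.prodMk hY) hD
  change ∫ y, D.indicator f (u, y) ∂P.map Y = ∫ ω in {ω | (u, Y ω) ∈ D}, f (u, Y ω) ∂P
  rw [integral_map hY.aemeasurable hsec.aestronglyMeasurable, ← integral_indicator hDu]
  rfl

/-- Independence of `σ(X)` and `m`, as independence of `X` and the identity onto `(Ω, m)`. -/
theorem indepFun_id_of_indep_comap {Ω E : Type*} {m : MeasurableSpace Ω}
    [mΩ : MeasurableSpace Ω] [mE : MeasurableSpace E] {P : Measure Ω} {X : Ω → E}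
    (hind : Indep (MeasurableSpace.comap X mE) m P) :
    @IndepFun Ω E Ω mΩ mE m X id P := by
  refine (@IndepFun_iff_Indep Ω E Ω mΩ mE m X id P).2 ?_
  rwa [MeasurableSpace.comap_id]

/-- Enlarging `m` by `σ(X)` amounts to pulling back the product `σ`-algebra along the graph
of `X`. -/
theorem sup_comap_eq_comap_graph {Ω E : Type*} (m : MeasurableSpace Ω)
    [mE : MeasurableSpace E] (X : Ω → E) :
    m ⊔ MeasurableSpace.comap X mE
      = (MeasurableSpace.prod mE m).comap (fun ω => (X ω, ω)) := by
  rw [MeasurableSpace.prod, MeasurableSpace.comap_sup, MeasurableSpace.comap_comp,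
    MeasurableSpace.comap_comp, sup_comm]
  congr 1
  exact MeasurableSpace.comap_id.symm

/-- Substituting `X` into a jointly measurable function is measurable for `m ⊔ σ(X)`. -/
theorem measurable_substitution_sup_comap {Ω E : Type*} {m : MeasurableSpace Ω}
    [mE : MeasurableSpace E] {X : Ω → E} {f : E → Ω → ℝ}
    (hf : @Measurable (E × Ω) ℝ (MeasurableSpace.prod mE m) _ (fun p => f p.1 p.2)) :
    Measurable[m ⊔ MeasurableSpace.comap X mE] (fun ω => f (X ω) ω) := by
  rw [sup_comap_eq_comap_graph]
  exact fun s hs => ⟨_, hf hs, rfl⟩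

/-- Substituting `X` into the frozen variable commutes with conditional expectation, when
conditioning on a sub-`σ`-algebra enlarged by `σ(X)`, provided `X` is independent of `m`. -/
theorem condExp_substitution_sup_comap {Ω E : Type*} {m' m : MeasurableSpace Ω}
    [mΩ : MeasurableSpace Ω] [mE : MeasurableSpace E] {P : Measure Ω} [IsProbabilityMeasure P]
    (hm' : m' ≤ m) (hm : m ≤ mΩ) {X : Ω → E} (hX : Measurable X)
    (hind : Indep (MeasurableSpace.comap X inferInstance) m P) {f g : E → Ω → ℝ}
    (hf : @Measurable (E × Ω) ℝ (MeasurableSpace.prod inferInstance m) _ (fun p => f p.1 p.2))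
    (hg : @Measurable (E × Ω) ℝ (MeasurableSpace.prod inferInstance m') _ (fun p => g p.1 p.2))
    (hfu : ∀ᵐ u ∂P.map X, Integrable (f u) P)
    (hfX : Integrable (fun ω => f (X ω) ω) P) (hgX : Integrable (fun ω => g (X ω) ω) P)
    (hfg : ∀ᵐ u ∂P.map X, P[f u | m'] =ᵐ[P] g u) :
    P[fun ω => f (X ω) ω | m' ⊔ MeasurableSpace.comap X inferInstance]
      =ᵐ[P] fun ω => g (X ω) ω := by
  have hle : m' ⊔ MeasurableSpace.comap X inferInstance ≤ mΩ :=
    sup_le (hm'.trans hm) hX.comap_le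
  have hY : @Measurable Ω Ω mΩ m id := measurable_id'' hm
  have hXY := indepFun_id_of_indep_comap hind
  have hprod : MeasurableSpace.prod mE m' ≤ MeasurableSpace.prod mE m :=
    sup_le_sup le_rfl (MeasurableSpace.comap_mono hm')
  refine (ae_eq_condExp_of_forall_setIntegral_eq hle hfX (fun _ _ _ => hgX.integrableOn) ?_
    (measurable_substitution_sup_comap hg).stronglyMeasurable.aestronglyMeasurable).symm
  intro C hC _
  obtain ⟨D, hD, rfl⟩ : ∃ D : Set (E × Ω),
      MeasurableSet[MeasurableSpace.prod inferInstance m'] D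
        ∧ (fun ω => (X ω, ω)) ⁻¹' D = C := by
    rw [sup_comap_eq_comap_graph] at hC
    exact hC
  have key {h : E → Ω → ℝ}
      (hh : @Measurable (E × Ω) ℝ (MeasurableSpace.prod inferInstance m) _ (fun p => h p.1 p.2))
      (hhX : Integrable (fun ω => h (X ω) ω) P) :=
    @setIntegral_comp_prodMk_of_indepFun Ω E Ω mΩ _ m P _ X id hX hY hXY _ hh hhX D (hprod _ hD)
  refine (key (hg.mono hprod le_rfl) hgX).trans (Eq.trans ?_ (key hf hfX).symm)
  refine integral_congr_ae ?_
  filter_upwards [hfg, hfu] with u hu hui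
  have hDu : MeasurableSet[m'] {ω | (u, ω) ∈ D} :=
    (@measurable_prodMk_left E Ω _ m' u) hD
  refine Eq.trans ?_ (setIntegral_condExp (hm'.trans hm) hui hDu)
  exact integral_congr_ae (ae_restrict_of_ae hu.symm)

/-- If `(N^u_t)` is, for each `u ∈ [0,T]`, a `(P,𝒢)`-martingale, jointly measurable
in `(u,ω)`, with `∫ E|N^u_t| μ_τ(du) < ∞`, and `τ` is independent of `𝒢_T`, then
the process `t ↦ N^τ_t` is a martingale for the initially enlarged filtration
`ℱ_t = 𝒢_t ∨ σ(τ)`. -/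
theorem substituted_process_martingale_initially_enlarged
    {Ω : Type*} [mΩ : MeasurableSpace Ω] (P : Measure Ω) [IsProbabilityMeasure P]
    (T : ℝ) (hT : 0 < T)
    (G : ℝ → MeasurableSpace Ω)
    (hGmono : ∀ s t : ℝ, s ∈ Set.Icc 0 T → t ∈ Set.Icc 0 T → s ≤ t → G s ≤ G t)
    (hGle : ∀ t ∈ Set.Icc (0:ℝ) T, G t ≤ mΩ)
    (τ : Ω → ℝ) (hτmeas : Measurable τ) (hτrange : ∀ ω, τ ω ∈ Set.Icc 0 T)
    (hτindep : ProbabilityTheory.Indep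
      (MeasurableSpace.comap τ inferInstance) (G T) P)
    (N : ℝ → ℝ → Ω → ℝ)
    (hNjm : ∀ t ∈ Set.Icc (0:ℝ) T,
      @Measurable (ℝ × Ω) ℝ (MeasurableSpace.prod inferInstance (G t)) _
        (fun p => N p.1 t p.2))
    (hNint : ∀ u ∈ Set.Icc (0:ℝ) T, ∀ t ∈ Set.Icc (0:ℝ) T, Integrable (N u t) P)
    (hNadapted : ∀ u ∈ Set.Icc (0:ℝ) T, ∀ t ∈ Set.Icc (0:ℝ) T,
      Measurable[G t] (N u t))
    (hNmart : ∀ u ∈ Set.Icc (0:ℝ) T, ∀ s ∈ Set.Icc (0:ℝ) T, ∀ t ∈ Set.Icc (0:ℝ) T,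
      s ≤ t → P[N u t | G s] =ᵐ[P] N u s)
    (hNabs : ∀ t ∈ Set.Icc (0:ℝ) T,
      Integrable (fun u => ∫ ω, |N u t ω| ∂P) (P.map τ)) :
    (∀ t ∈ Set.Icc (0:ℝ) T, Integrable (fun ω => N (τ ω) t ω) P) ∧
    (∀ t ∈ Set.Icc (0:ℝ) T,
      Measurable[G t ⊔ MeasurableSpace.comap τ inferInstance]
        (fun ω => N (τ ω) t ω)) ∧
    (∀ s ∈ Set.Icc (0:ℝ) T, ∀ t ∈ Set.Icc (0:ℝ) T, s ≤ t →
      P[fun ω => N (τ ω) t ω | G s ⊔ MeasurableSpace.comap τ inferInstance]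
        =ᵐ[P] fun ω => N (τ ω) s ω) := by
  have hTT : T ∈ Set.Icc (0 : ℝ) T := ⟨hT.le, le_rfl⟩
  have hτae : ∀ᵐ u ∂P.map τ, u ∈ Set.Icc (0 : ℝ) T :=
    (ae_map_iff hτmeas.aemeasurable measurableSet_Icc).2 (ae_of_all _ hτrange)
  have hind (t : ℝ) (ht : t ∈ Set.Icc (0 : ℝ) T) :
      Indep (MeasurableSpace.comap τ inferInstance) (G t) P :=
    indep_of_indep_of_le_right hτindep (hGmono t T ht hTT ht.2)
  have hNτ (t : ℝ) (ht : t ∈ Set.Icc (0 : ℝ) T) : Integrable (fun ω => N (τ ω) t ω) P :=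
    @integrable_comp_prodMk_of_indepFun Ω ℝ Ω mΩ _ (G t) P _ τ id hτmeas
      (measurable_id'' (hGle t ht)) (indepFun_id_of_indep_comap (hind t ht)) _ (hNjm t ht)
      (hτae.mono fun u hu => hNint u hu t ht) (hNabs t ht)
  refine ⟨hNτ, fun t ht =>
    measurable_substitution_sup_comap (f := fun u => N u t) (hNjm t ht), fun s hs t ht hst => ?_⟩
  exact condExp_substitution_sup_comap (f := fun u => N u t) (g := fun u => N u s)
    (hGmono s t hs ht hst) (hGle t ht) hτmeas (hind t ht) (hNjm t ht) (hNjm s hs)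
    (hτae.mono fun u hu => hNint u hu t ht) (hNτ t ht) (hNτ s hs)
    (hτae.mono fun u hu => hNmart u hu s hs t ht hst)
end

section
/- Let (T, 𝒯, α) be a probability space and let k : T → ℝ be measurable with 0 < ∫_T e^{−k} dα < ∞. Then for every measurable c : T → [0,∞) with ∫_T c dα = 1 such that the function c·ln(c) + c·k is α-integrable (with the convention 0·ln(0) = 0), one has ∫_T (c·ln(c) + c·k) dα ≥ −ln(∫_T e^{−k} dα), and equality holds if and only if c = e^{−k}/∫_T e^{−k} dα α-almost everywhere. -/
open MeasureTheory

/-- The pointwise gap in the Gibbs inequality, written through `klFun x = x log x + 1 - x`. -/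
lemma mul_klFun_div_exp_neg_div {x a Z : ℝ} (hZ : 0 < Z) :
    Real.exp (-a) / Z * InformationTheory.klFun (x / (Real.exp (-a) / Z)) =
      x * Real.log x + x * a + x * Real.log Z + Real.exp (-a) / Z - x := by
  rcases eq_or_ne x 0 with rfl | hx
  · simp [InformationTheory.klFun_zero]
  · have hq : Real.exp (-a) / Z ≠ 0 := (div_pos (Real.exp_pos _) hZ).ne'
    have hlog : Real.log (x / (Real.exp (-a) / Z)) = Real.log x + a + Real.log Z := by
      rw [Real.log_div hx hq, Real.log_div (Real.exp_ne_zero _) hZ.ne', Real.log_exp]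
      ring
    rw [InformationTheory.klFun_apply, hlog]
    field_simp

/-- Gibbs-type constrained minimisation: among densities `c ≥ 0` with `∫ c dα = 1`,
the functional `∫ (c ln c + c k) dα` is minimised by `c = e^{-k} / ∫ e^{-k} dα`,
with minimal value `-ln(∫ e^{-k} dα)`; equality holds only at this density. -/
theorem entropy_divergence_normalizing_factor
    {T : Type*} [MeasurableSpace T] (α : Measure T) [IsProbabilityMeasure α]
    (k : T → ℝ) (hk : Measurable k)
    (hI : Integrable (fun t => Real.exp (-k t)) α)
    (hpos : 0 < ∫ t, Real.exp (-k t) ∂α) :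
    ∀ c : T → ℝ, Measurable c → (∀ t, 0 ≤ c t) → Integrable c α →
      (∫ t, c t ∂α = 1) →
      Integrable (fun t => c t * Real.log (c t) + c t * k t) α →
      (-Real.log (∫ t, Real.exp (-k t) ∂α)
          ≤ ∫ t, (c t * Real.log (c t) + c t * k t) ∂α) ∧
      ((∫ t, (c t * Real.log (c t) + c t * k t) ∂α
          = -Real.log (∫ t, Real.exp (-k t) ∂α)) ↔
        c =ᵐ[α] fun t => Real.exp (-k t) / ∫ s, Real.exp (-k s) ∂α) := by
  intro c _ hc0 hc hc1 hF
  set Z := ∫ t, Real.exp (-k t) ∂α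
  have hq (t : T) : 0 < Real.exp (-k t) / Z := div_pos (Real.exp_pos _) hpos
  let gap : T → ℝ := fun t =>
    Real.exp (-k t) / Z * InformationTheory.klFun (c t / (Real.exp (-k t) / Z))
  have hgap : gap = (fun t => c t * Real.log (c t) + c t * k t) + (fun t => c t * Real.log Z) +
      (fun t => Real.exp (-k t) / Z) - c := funext fun t => mul_klFun_div_exp_neg_div hpos
  have hgap_nonneg : 0 ≤ gap := fun t =>
    mul_nonneg (hq t).le (InformationTheory.klFun_nonneg (div_nonneg (hc0 t) (hq t).le))
  have hcZ : Integrable (fun t => c t * Real.log Z) α := hc.mul_const _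
  have hqI : Integrable (fun t => Real.exp (-k t) / Z) α := hI.div_const _
  have hgap_int : Integrable gap α := by
    rw [hgap]
    exact ((hF.add hcZ).add hqI).sub hc
  have hgap_integral : ∫ t, gap t ∂α =
      ∫ t, (c t * Real.log (c t) + c t * k t) ∂α + Real.log Z := by
    rw [hgap, integral_sub' ((hF.add hcZ).add hqI) hc, integral_add' (hF.add hcZ) hqI,
      integral_add' hF hcZ, integral_mul_const, integral_div, hc1, div_self hpos.ne']
    ring
  have hgap_zero (t : T) : gap t = 0 ↔ c t = Real.exp (-k t) / Z := by
    simp only [gap, mul_eq_zero, (hq t).ne', false_or,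
      InformationTheory.klFun_eq_zero_iff (div_nonneg (hc0 t) (hq t).le),
      div_eq_one_iff_eq (hq t).ne']
  refine ⟨?_, ?_⟩
  · linarith [integral_nonneg (μ := α) hgap_nonneg]
  · rw [eq_neg_iff_add_eq_zero, ← hgap_integral,
      integral_eq_zero_iff_of_nonneg hgap_nonneg hgap_int]
    exact Filter.eventually_congr (.of_forall hgap_zero)
end
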